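/- Let X₁, …, Xₙ be standard Borel (Polish) spaces and, for each i, let cᵢ : Xᵢ × Xᵢ → [0,∞] be a nonnegative lower semicontinuous cost function. Let μ = μ₁ ⊗ ⋯ ⊗ μₙ be a product probability measure on X = ∏ᵢ Xᵢ and ν any probability measure on X. For ν-almost every x ∈ X and each i, let νᵢ(· | x̂ᵢ) denote the regular conditional distribution under ν of the i-th coordinate given the remaining coordinates x̂ᵢ = (x₁,…,x_{i−1},x_{i+1},…,xₙ). Then, with the sum cost (⊕ᵢcᵢ)(x,y) = Σᵢ cᵢ(xᵢ, yᵢ), one has T_{⊕ᵢcᵢ}(μ, ν) ≤ ∫ Σᵢ T_{cᵢ}(μᵢ, νᵢ(· | x̂ᵢ)) dν(x). -/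

import Mathlib

open MeasureTheory

/-- The transportation cost `T_c(β, γ)` from `β` to `γ` for a cost `c`, as the infimum
of `∫ c dπ` over all couplings `π` with first marginal `β` and second marginal `γ`. -/
noncomputable def transportCost {Y : Type*} [MeasurableSpace Y]
    (c : Y → Y → ENNReal) (β γ : Measure Y) : ENNReal :=
  ⨅ (cpl : Measure (Y × Y)) (_ : cpl.map Prod.fst = β) (_ : cpl.map Prod.snd = γ),
    ∫⁻ z, c z.1 z.2 ∂cpl

open ProbabilityTheory TopologicalSpace Filter Topology
open scoped NNReal ENNReal

/-- A countable supremum of continuous functions is the supremum of an increasing sequence of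
continuous functions. -/
theorem exists_monotone_continuous_iSup_eq {Z ι : Type*} [TopologicalSpace Z] [Countable ι]
    [Nonempty ι] {g : ι → Z → ℝ≥0} (hg : ∀ a, Continuous (g a)) :
    ∃ f : ℕ → Z → ℝ≥0, (∀ m, Continuous (f m)) ∧ Monotone f ∧
      ∀ z, ⨆ m, (f m z : ℝ≥0∞) = ⨆ a, (g a z : ℝ≥0∞) := by
  obtain ⟨u, hu⟩ := exists_surjective_nat ι
  refine ⟨partialSups (g ∘ u), fun m => ?_, (partialSups (g ∘ u)).monotone, fun z => ?_⟩
  · induction m with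
    | zero => simpa using hg _
    | succ m ih => rw [partialSups_add_one]; exact ih.sup (hg _)
  · apply le_antisymm
    · refine iSup_le fun m => ?_
      induction m with
      | zero => simpa using le_iSup (fun a => (g a z : ℝ≥0∞)) (u 0)
      | succ m ih =>
        rw [partialSups_add_one, Pi.sup_apply, ENNReal.coe_mono.map_sup]
        exact sup_le ih (le_iSup (fun a => (g a z : ℝ≥0∞)) (u (m + 1)))
    · refine iSup_le fun a => ?_
      obtain ⟨m, rfl⟩ := hu a
      exact le_iSup_of_le m (ENNReal.coe_le_coe.2 (le_partialSups (g ∘ u) m z))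

/-- A lower semicontinuous cost on a second countable space is the pullback, under an injective
Borel map into the Cantor space, of an increasing supremum of continuous functions. -/
theorem exists_cantor_coding_of_lowerSemicontinuous {Y : Type*} [MeasurableSpace Y]
    [Nonempty Y] [TopologicalSpace Y] [T0Space Y] [SecondCountableTopology Y]
    [OpensMeasurableSpace Y]
    {c : Y → Y → ℝ≥0∞} (hc : LowerSemicontinuous fun p : Y × Y => c p.1 p.2) :
    ∃ e : Y → ℕ → Bool, Measurable e ∧ Function.Injective e ∧
      ∃ f : ℕ → (ℕ → Bool) × (ℕ → Bool) → ℝ≥0, (∀ m, Continuous (f m)) ∧ Monotone f ∧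
        ∀ y y', c y y' = ⨆ m, (f m (e y, e y') : ℝ≥0∞) := by
  classical
  obtain ⟨U, hU⟩ := (countable_countableBasis Y).exists_eq_range
    ⟨_, ((isBasis_countableBasis Y).exists_subset_of_mem_open
      (Set.mem_univ (Classical.arbitrary Y)) isOpen_univ).choose_spec.1⟩
  have hB : IsTopologicalBasis (Set.range U) := hU ▸ isBasis_countableBasis Y
  have hUo (m) : IsOpen (U m) := hB.isOpen ⟨m, rfl⟩
  let e : Y → ℕ → Bool := fun y m => decide (y ∈ U m)
  have he : Measurable e := measurable_pi_iff.2 fun m => measurable_to_bool <| by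
    convert (hUo m).measurableSet
    ext y
    simp [e]
  have hinj : Function.Injective e := by
    intro y y' h
    refine hB.eq_iff.2 ?_
    rintro _ ⟨m, rfl⟩
    simpa [e] using congrFun h m
  let g : ℕ × ℕ × ℚ → (ℕ → Bool) × (ℕ → Bool) → ℝ≥0 := fun a z =>
    if ∀ y ∈ U a.1, ∀ y' ∈ U a.2.1, (Real.toNNReal a.2.2 : ℝ≥0∞) ≤ c y y' then
      (if z.1 a.1 = true ∧ z.2 a.2.1 = true then Real.toNNReal a.2.2 else 0) else 0
  have hg (a) : Continuous (g a) := by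
    by_cases h : ∀ y ∈ U a.1, ∀ y' ∈ U a.2.1, (Real.toNNReal a.2.2 : ℝ≥0∞) ≤ c y y'
    · simp only [g, if_pos h]
      have : Continuous fun b : Bool × Bool => if b.1 = true ∧ b.2 = true
        then Real.toNNReal a.2.2 else 0 := continuous_of_discreteTopology
      exact this.comp (f := fun z : (ℕ → Bool) × (ℕ → Bool) => (z.1 a.1, z.2 a.2.1)) (by fun_prop)
    · simp only [g, if_neg h]
      exact continuous_const
  obtain ⟨f, hf, hmono, hsup⟩ := exists_monotone_continuous_iSup_eq hg
  refine ⟨e, he, hinj, f, hf, hmono, fun y y' => ?_⟩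
  rw [hsup]
  apply le_antisymm
  · refine le_of_forall_lt fun r hr => ?_
    obtain ⟨q, -, hrq, hqc⟩ := ENNReal.lt_iff_exists_rat_btwn.1 hr
    obtain ⟨V, hV, V', hV', hVV⟩ := mem_nhds_prod_iff.1 (hc (y, y') _ hqc)
    obtain ⟨_, ⟨i, rfl⟩, hyi, hi⟩ := hB.mem_nhds_iff.1 hV
    obtain ⟨_, ⟨j, rfl⟩, hyj, hj⟩ := hB.mem_nhds_iff.1 hV'
    refine hrq.trans_le (le_iSup_of_le (i, j, q) ?_)
    have hle : ∀ z ∈ U i, ∀ z' ∈ U j, (Real.toNNReal q : ℝ≥0∞) ≤ c z z' :=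
      fun z hz z' hz' => (hVV (Set.mk_mem_prod (hi hz) (hj hz'))).le
    simp [g, e, if_pos hle, hyi, hyj]
  · refine iSup_le fun a => ?_
    simp only [g, e]
    split_ifs with h1 h2
    · simp only [decide_eq_true_eq] at h2
      exact h1 _ h2.1 _ h2.2
    · simp
    · simp

/-- Limits of push-forwards to a profinite space are identified by the masses of clopen sets. -/
theorem map_eq_of_tendsto {Z W ι : Type*} [TopologicalSpace Z] [MeasurableSpace Z]
    [BorelSpace Z] [TopologicalSpace W] [MeasurableSpace W] [BorelSpace W]
    [T2Space W] [CompactSpace W] [TotallyDisconnectedSpace W] [SecondCountableTopology W]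
    [HasOuterApproxClosed W]
    {l : Filter ι} [l.NeBot] {ρs : ι → ProbabilityMeasure Z} {ρ : ProbabilityMeasure Z}
    (h : Tendsto ρs l (𝓝 ρ)) {g : Z → W} (hg : Continuous g) {m : Measure W}
    (hm : ∀ D : Set W, IsClopen D →
      Tendsto (fun k => (ρs k : Measure Z).map g D) l (𝓝 (m D))) :
    (ρ : Measure Z).map g = m := by
  have hlim := ProbabilityMeasure.tendsto_map_of_tendsto_of_continuous ρs ρ h hg
  have key (D : Set W) (hD : IsClopen D) : (ρ : Measure Z).map g D = m D := by
    refine tendsto_nhds_unique ?_ (hm D hD)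
    exact ProbabilityMeasure.tendsto_measure_of_null_frontier_of_tendsto' hlim
      (by simp [hD.frontier_eq])
  refine ext_of_generate_finite _ ((BorelSpace.measurable_eq).trans
    isTopologicalBasis_isClopen.borel_eq_generateFrom) ?_ key (key _ isClopen_univ)
  exact fun s hs t ht _ => hs.inter ht

/-- Convergence of kernels on the sections of a set gives convergence of the composition-products on
that set. -/
theorem tendsto_compProd_apply {Ω W : Type*} [MeasurableSpace Ω] [MeasurableSpace W]
    {P : Measure Ω} [IsFiniteMeasure P] {γ : ℕ → Kernel Ω W} {κ : Kernel Ω W}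
    [∀ k, IsMarkovKernel (γ k)] [IsMarkovKernel κ] {D : Set (Ω × W)} (hD : MeasurableSet D)
    (h : ∀ x, Tendsto (fun k => γ k x (Prod.mk x ⁻¹' D)) atTop (𝓝 (κ x (Prod.mk x ⁻¹' D)))) :
    Tendsto (fun k => (P ⊗ₘ γ k) D) atTop (𝓝 ((P ⊗ₘ κ) D)) := by
  simp_rw [Measure.compProd_apply hD]
  refine tendsto_lintegral_of_dominated_convergence (fun _ => 1)
    (fun k => Kernel.measurable_kernel_prodMk_left hD) (fun k => .of_forall fun x => prob_le_one)
    (by simp) (.of_forall h)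

/-- Approximate selection of nearly optimal couplings. -/
theorem exists_kernel_coupling_approx {Ω Y : Type*} [MeasurableSpace Ω] [MeasurableSpace Y]
    {P : Measure Ω} [IsProbabilityMeasure P] {μ : Measure Y} [IsProbabilityMeasure μ]
    {κ : Kernel Ω Y} [IsMarkovKernel κ] {c : Y → Y → ℝ≥0∞} {ε : ℝ≥0∞} (hε : ε ≠ 0)
    {D : ℕ → Set Y} (hD : ∀ m, MeasurableSet (D m)) (k : ℕ) :
    ∃ Q : Kernel Ω (Y × Y), IsMarkovKernel Q ∧ (∀ x, (Q x).map Prod.fst = μ) ∧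
      (∀ x, ∀ m < k, k * |((Q x).map Prod.snd).real (D m) - (κ x).real (D m)| ≤ 1) ∧
      ∫⁻ x, ∫⁻ z, c z.1 z.2 ∂Q x ∂P ≤ ∫⁻ x, transportCost c μ (κ x) ∂P + ε := by
  let s : Ω → Fin k → ℕ := fun x m => ⌊k * (κ x).real (D m)⌋₊
  have hs : Measurable s := measurable_pi_iff.2 fun m =>
    Nat.measurable_floor.comp ((Kernel.measurable_coe κ (hD m)).ennreal_toReal.const_mul _)
  let h : (Fin k → ℕ) → ℝ≥0∞ := fun v => ⨅ (x) (_ : s x = v), transportCost c μ (κ x)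
  have hcpl (v) : ∃ π : Measure (Y × Y), IsProbabilityMeasure π ∧ π.map Prod.fst = μ ∧
      (∀ x, s x = v → ∃ x', s x' = v ∧ π.map Prod.snd = κ x') ∧
      ((∃ x, s x = v) → ∫⁻ z, c z.1 z.2 ∂π ≤ h v + ε) := by
    by_cases hv : ∃ x, s x = v
    · obtain ⟨x₀, hx₀⟩ := hv
      by_cases htop : h v = ∞
      · refine ⟨μ.prod (κ x₀), inferInstance, ?_, fun _ _ => ⟨x₀, hx₀, ?_⟩, fun _ => ?_⟩
        · simp [Measure.map_fst_prod]
        · simp [Measure.map_snd_prod]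
        · simp [htop]
      · have hlt : h v < h v + ε := ENNReal.lt_add_right htop hε
        simp only [h, transportCost] at hlt
        simp only [iInf_lt_iff] at hlt
        obtain ⟨x, hx, ρ, hρ1, hρ2, hρ⟩ := hlt
        refine ⟨ρ, ⟨?_⟩, hρ1, fun _ _ => ⟨x, hx, hρ2⟩, fun _ => hρ.le⟩
        rw [← Set.preimage_univ (f := Prod.fst), ← Measure.map_apply measurable_fst .univ, hρ1,
          measure_univ]
    · push Not at hv
      exact ⟨μ.prod μ, inferInstance, by simp [Measure.map_fst_prod],
        fun x hx => absurd hx (hv x), fun ⟨x, hx⟩ => absurd hx (hv x)⟩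
  choose π hπ hπ1 hπ2 hπ3 using hcpl
  refine ⟨(Kernel.ofFunOfCountable π).comap s hs, ⟨fun x => hπ (s x)⟩, fun x => hπ1 (s x),
    fun x m hm => ?_, ?_⟩
  · obtain ⟨x', hx', hx2⟩ := hπ2 (s x) x rfl
    change _ * |((π (s x)).map Prod.snd).real (D m) - _| ≤ 1
    have := congrFun hx' ⟨m, hm⟩
    simp only [s] at this
    have h1 := Nat.floor_le (a := k * (κ x).real (D m)) (by positivity)
    have h2 := Nat.floor_le (a := k * (κ x').real (D m)) (by positivity)
    have h3 := Nat.lt_floor_add_one (k * (κ x).real (D m))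
    have h4 := Nat.lt_floor_add_one (k * (κ x').real (D m))
    rw [this] at h2 h4
    rw [hx2, ← abs_of_nonneg (Nat.cast_nonneg (α := ℝ) k), ← abs_mul, abs_le]
    constructor <;> nlinarith
  · calc ∫⁻ x, ∫⁻ z, c z.1 z.2 ∂π (s x) ∂P ≤ ∫⁻ x, (h (s x) + ε) ∂P :=
          lintegral_mono fun x => hπ3 (s x) ⟨x, rfl⟩
      _ = ∫⁻ x, h (s x) ∂P + ε := by
          rw [lintegral_add_right _ measurable_const]; simp
      _ ≤ _ := by
          gcongr with x
          exact iInf₂_le (f := fun y (_ : s y = s x) => transportCost c μ (κ y)) x rfl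

/-- Selection, for almost every parameter, of couplings that are nearly optimal on average. The
right-hand side is a lower integral, so that no measurability of the transportation cost in the
parameter is needed. -/
theorem exists_kernel_coupling {Ω Y : Type*} [MeasurableSpace Ω] [StandardBorelSpace Ω]
    [MeasurableSpace Y] [TopologicalSpace Y] [PolishSpace Y] [BorelSpace Y]
    {P : Measure Ω} [IsProbabilityMeasure P] {μ : Measure Y} [IsProbabilityMeasure μ]
    {κ : Kernel Ω Y} [IsMarkovKernel κ] {c : Y → Y → ℝ≥0∞}
    (hc : LowerSemicontinuous fun p : Y × Y => c p.1 p.2) {ε : ℝ≥0∞} (hε : ε ≠ 0) :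
    ∃ Q : Kernel Ω (Y × Y), IsMarkovKernel Q ∧ (∀ᵐ x ∂P, (Q x).map Prod.fst = μ) ∧
      (∀ᵐ x ∂P, (Q x).map Prod.snd = κ x) ∧
      ∫⁻ x, ∫⁻ z, c z.1 z.2 ∂Q x ∂P ≤ ∫⁻ x, transportCost c μ (κ x) ∂P + ε := by
  have hΩ : Nonempty Ω := P.nonempty_of_neZero
  have hY : Nonempty Y := μ.nonempty_of_neZero
  obtain ⟨e, he, hinj, f, hf, hmono, hcf⟩ := exists_cantor_coding_of_lowerSemicontinuous hc
  obtain ⟨j, hj, hjinj⟩ := MeasurableSpace.measurable_injection_nat_bool_of_countablySeparated Ω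
  have hee := he.measurableEmbedding hinj
  obtain ⟨r, hr, hre⟩ := hee.exists_measurable_extend measurable_id fun _ => hY
  obtain ⟨t, ht, htj⟩ := (hj.measurableEmbedding hjinj).exists_measurable_extend measurable_id
    fun _ => hΩ
  have : Countable (Clopens (ℕ → Bool)) :=
    Clopens.countable_iff_secondCountable.2 inferInstance
  obtain ⟨C, hC⟩ := exists_surjective_nat (Clopens (ℕ → Bool))
  have hD (m) : MeasurableSet (e ⁻¹' (C m : Set (ℕ → Bool))) :=
    he (C m).isClopen.isOpen.measurableSet
  choose Q hQ hQ1 hQ2 hQ3 using exists_kernel_coupling_approx (P := P) (μ := μ) (κ := κ) (c := c)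
    hε hD
  have hjee : Measurable (Prod.map j (Prod.map e e)) := hj.prodMap (he.prodMap he)
  let ρs (k) : ProbabilityMeasure ((ℕ → Bool) × (ℕ → Bool) × (ℕ → Bool)) :=
    ⟨(P ⊗ₘ Q k).map (Prod.map j (Prod.map e e)),
      Measure.isProbabilityMeasure_map hjee.aemeasurable⟩
  have : CompactSpace (ProbabilityMeasure ((ℕ → Bool) × (ℕ → Bool) × (ℕ → Bool))) :=
    instCompactSpaceProbabilityMeasure
  obtain ⟨ρ, -, hρ⟩ := isCompact_univ.ultrafilter_le_nhds ((hyperfilter ℕ).map ρs) (by simp)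
  replace hρ : Tendsto ρs (hyperfilter ℕ) (𝓝 ρ) := hρ
  have hγ1 (k) : (P ⊗ₘ Q k).map (Prod.map id Prod.fst) = P.prod μ := by
    rw [← Measure.compProd_map measurable_fst, ← Measure.compProd_const]
    refine Measure.compProd_congr (.of_forall fun x => ?_)
    rw [Kernel.map_apply _ measurable_fst, hQ1, Kernel.const_apply]
  have hm1 : ρ.toMeasure.map (fun z => (z.1, z.2.1)) = (P.prod μ).map (Prod.map j e) := by
    refine map_eq_of_tendsto hρ (by fun_prop) fun D hD => ?_
    refine tendsto_const_nhds.congr fun k => ?_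
    rw [← hγ1 k, Measure.map_map (by fun_prop) (by fun_prop)]
    change _ = ((P ⊗ₘ Q k).map (Prod.map j (Prod.map e e))).map _ D
    rw [Measure.map_map (by fun_prop) hjee]
    rfl
  have hm2 : ρ.toMeasure.map (fun z => (z.1, z.2.2)) = (P ⊗ₘ κ).map (Prod.map j e) := by
    refine map_eq_of_tendsto hρ (by fun_prop) fun D hD => ?_
    have hje : Measurable (Prod.map j e) := hj.prodMap he
    have := fun k => Kernel.IsMarkovKernel.map (Q k) (measurable_snd)
    have hlim := tendsto_compProd_apply (P := P) (γ := fun k => (Q k).map Prod.snd) (κ := κ)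
      (hje hD.isOpen.measurableSet) fun x => ?_
    · refine ((hlim.mono_left Nat.hyperfilter_le_atTop).congr fun k => ?_).trans_eq ?_
      · rw [Measure.compProd_map measurable_snd, Measure.map_apply (by fun_prop)
          (hje hD.isOpen.measurableSet)]
        change _ = ((P ⊗ₘ Q k).map (Prod.map j (Prod.map e e))).map _ D
        rw [Measure.map_map (by fun_prop) hjee, Measure.map_apply (by fun_prop)
          hD.isOpen.measurableSet]
        rfl
      · rw [Measure.map_apply hje hD.isOpen.measurableSet]
    · obtain ⟨m, hm⟩ := hC ⟨Prod.mk (j x) ⁻¹' D, hD.preimage (by fun_prop)⟩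
      have hsec : Prod.mk x ⁻¹' (Prod.map j e ⁻¹' D) = e ⁻¹' (C m : Set (ℕ → Bool)) := by
        rw [hm]; rfl
      rw [hsec, ← ENNReal.tendsto_toReal_iff (fun _ => measure_ne_top _ _) (measure_ne_top _ _)]
      refine tendsto_iff_dist_tendsto_zero.2 (squeeze_zero' (.of_forall fun _ => dist_nonneg) ?_
        (tendsto_one_div_atTop_nhds_zero_nat (𝕜 := ℝ)))
      filter_upwards [eventually_gt_atTop m] with k hk
      have := hQ2 k x m hk
      rw [Real.dist_eq, le_div_iff₀' (by exact_mod_cast (Nat.zero_le m).trans_lt hk),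
        Kernel.map_apply _ measurable_snd]
      exact this
  have hcost : ∫⁻ z, ⨆ m, (f m z.2 : ℝ≥0∞) ∂ρ.toMeasure
      ≤ ∫⁻ x, transportCost c μ (κ x) ∂P + ε := by
    rw [lintegral_iSup]
    · refine iSup_le fun m => ?_
      have := ProbabilityMeasure.tendsto_iff_forall_lintegral_tendsto.1 hρ
        (BoundedContinuousFunction.mkOfCompact ⟨fun z => f m z.2, (hf m).comp continuous_snd⟩)
      refine le_of_tendsto this (.of_forall fun k => ?_)
      change ∫⁻ z, (f m z.2 : ℝ≥0∞) ∂((P ⊗ₘ Q k).map (Prod.map j (Prod.map e e))) ≤ _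
      have hfm := (hf m).measurable
      rw [lintegral_map (by fun_prop) hjee, Measure.lintegral_compProd (by fun_prop)]
      refine le_trans ?_ (hQ3 k)
      gcongr with x z
      rw [hcf]
      exact le_iSup (fun m => (f m (e z.1, e z.2) : ℝ≥0∞)) m
    · exact fun m => ((hf m).measurable.comp measurable_snd).coe_nnreal_ennreal
    · exact fun a b hab z => ENNReal.coe_le_coe.2 (hmono hab z.2)
  have htrr : Measurable (Prod.map t (Prod.map r r)) := ht.prodMap (hr.prodMap hr)
  let σ : Measure (Ω × Y × Y) := ρ.toMeasure.map (Prod.map t (Prod.map r r))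
  have hσ : IsProbabilityMeasure σ := Measure.isProbabilityMeasure_map htrr.aemeasurable
  have hcancel : Prod.map t r ∘ Prod.map j e = id := by
    rw [Prod.map_comp_map, htj, hre, Prod.map_id]
  have hσ1 : σ.map (Prod.map id Prod.fst) = P.prod μ := by
    rw [Measure.map_map (by fun_prop) htrr]
    have := congrArg (Measure.map (Prod.map t r)) hm1
    rw [Measure.map_map (by fun_prop) (by fun_prop), Measure.map_map (by fun_prop) (by fun_prop),
      hcancel, Measure.map_id] at this
    exact this
  have hσ2 : σ.map (Prod.map id Prod.snd) = P ⊗ₘ κ := by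
    rw [Measure.map_map (by fun_prop) htrr]
    have := congrArg (Measure.map (Prod.map t r)) hm2
    rw [Measure.map_map (by fun_prop) (by fun_prop), Measure.map_map (by fun_prop) (by fun_prop),
      hcancel, Measure.map_id] at this
    exact this
  have hfst : σ.fst = P := by
    have := congrArg Measure.fst hσ1
    rwa [Measure.fst_prod, Measure.fst, Measure.map_map measurable_fst (by fun_prop)] at this
  have hdis : P ⊗ₘ σ.condKernel = σ := by rw [← hfst, σ.disintegrate]
  refine ⟨σ.condKernel, inferInstance, ?_, ?_, ?_⟩
  · have h1 : P ⊗ₘ σ.condKernel.map Prod.fst = P ⊗ₘ Kernel.const Ω μ := by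
      rw [Measure.compProd_map measurable_fst, hdis, hσ1, Measure.compProd_const]
    filter_upwards [Kernel.ae_eq_of_compProd_eq h1] with x hx
    rw [← Kernel.map_apply _ measurable_fst, hx, Kernel.const_apply]
  · have h2 : P ⊗ₘ σ.condKernel.map Prod.snd = P ⊗ₘ κ := by
      rw [Measure.compProd_map measurable_snd, hdis, hσ2]
    filter_upwards [Kernel.ae_eq_of_compProd_eq h2] with x hx
    rw [← Kernel.map_apply _ measurable_snd, hx]
  · have hcm : Measurable fun p : Y × Y => c p.1 p.2 := hc.measurable
    rw [← Measure.lintegral_compProd (f := fun z : Ω × Y × Y => c z.2.1 z.2.2) (by fun_prop), hdis,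
      lintegral_map (by fun_prop) htrr]
    refine le_trans (lintegral_mono_ae ?_) hcost
    have hr1 : ∀ᵐ z ∂ρ.toMeasure, z.2.1 ∈ Set.range e := by
      have := congrArg (fun m => m (Prod.snd ⁻¹' (Set.range e)ᶜ)) hm1
      rw [Measure.map_apply (by fun_prop) (measurable_snd hee.measurableSet_range.compl),
        Measure.map_apply (by fun_prop) (measurable_snd hee.measurableSet_range.compl)] at this
      refine this.trans ?_
      convert measure_empty (μ := P.prod μ)
      ext; simp
    have hr2 : ∀ᵐ z ∂ρ.toMeasure, z.2.2 ∈ Set.range e := by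
      have := congrArg (fun m => m (Prod.snd ⁻¹' (Set.range e)ᶜ)) hm2
      rw [Measure.map_apply (by fun_prop) (measurable_snd hee.measurableSet_range.compl),
        Measure.map_apply (by fun_prop) (measurable_snd hee.measurableSet_range.compl)] at this
      refine this.trans ?_
      convert measure_empty (μ := P ⊗ₘ κ)
      ext; simp
    filter_upwards [hr1, hr2] with z ⟨y, hy⟩ ⟨y', hy'⟩
    obtain ⟨z0, z1, z2⟩ := z
    dsimp only at hy hy'
    subst hy hy'
    have hre' := congrFun hre
    simp only [Function.comp_apply, id_eq] at hre'
    simp [hre', hcf]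

/-- **Resampling one coordinate.** Given a coupling of a product measure and `ν`, redraw the `i`-th
coordinates from a kernel coupling `μ i` with the conditional law of the `i`-th coordinate under
`ν`. The result is again a coupling, and the costs in the other coordinates do not change. -/
theorem exists_coupling_resample {ι : Type*} [Fintype ι] [DecidableEq ι] {X : ι → Type*}
    [∀ i, MeasurableSpace (X i)] {μ : ∀ i, Measure (X i)} [∀ i, IsProbabilityMeasure (μ i)]
    {ν : Measure (∀ i, X i)} {i : ι} {κ : (∀ j, X j) → Measure (X i)}
    (hκ : ∀ F : (∀ j, X j) → ℝ≥0∞, Measurable F →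
      ∫⁻ x, F x ∂ν = ∫⁻ x, ∫⁻ y, F (Function.update x i y) ∂κ x ∂ν)
    {Q : Kernel (∀ j, X j) (X i × X i)} [IsMarkovKernel Q]
    (hQ1 : ∀ᵐ x ∂ν, (Q x).map Prod.fst = μ i) (hQ2 : ∀ᵐ x ∂ν, (Q x).map Prod.snd = κ x)
    {π : Measure ((∀ j, X j) × (∀ j, X j))} [IsProbabilityMeasure π]
    (hπ1 : π.map Prod.fst = Measure.pi μ) (hπ2 : π.map Prod.snd = ν) :
    ∃ π' : Measure ((∀ j, X j) × (∀ j, X j)), IsProbabilityMeasure π' ∧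
      π'.map Prod.fst = Measure.pi μ ∧ π'.map Prod.snd = ν ∧
      (∀ c : X i → X i → ℝ≥0∞, Measurable (fun p : X i × X i => c p.1 p.2) →
        ∫⁻ z, c (z.1 i) (z.2 i) ∂π' = ∫⁻ x, ∫⁻ p, c p.1 p.2 ∂Q x ∂ν) ∧
      ∀ j ≠ i, ∀ c : X j → X j → ℝ≥0∞, Measurable (fun p : X j × X j => c p.1 p.2) →
        ∫⁻ z, c (z.1 j) (z.2 j) ∂π' = ∫⁻ z, c (z.1 j) (z.2 j) ∂π := by
  let φ : ((∀ j, X j) × (∀ j, X j)) × X i × X i → (∀ j, X j) × (∀ j, X j) :=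
    fun w => (Function.update w.1.1 i w.2.1, Function.update w.1.2 i w.2.2)
  have hup : Measurable fun p : (∀ j, X j) × X i => Function.update p.1 i p.2 :=
    measurable_update'
  have hφ1 : Measurable fun w : ((∀ j, X j) × (∀ j, X j)) × X i × X i =>
      Function.update w.1.1 i w.2.1 :=
    hup.comp (f := fun w : ((∀ j, X j) × (∀ j, X j)) × X i × X i => (w.1.1, w.2.1)) (by fun_prop)
  have hφ2 : Measurable fun w : ((∀ j, X j) × (∀ j, X j)) × X i × X i =>
      Function.update w.1.2 i w.2.2 :=
    hup.comp (f := fun w : ((∀ j, X j) × (∀ j, X j)) × X i × X i => (w.1.2, w.2.2)) (by fun_prop)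
  have hφ : Measurable φ := hφ1.prodMk hφ2
  let R : Kernel ((∀ j, X j) × (∀ j, X j)) (X i × X i) := Q.comap Prod.snd measurable_snd
  have hR : IsMarkovKernel R := Kernel.IsMarkovKernel.comap Q measurable_snd
  have hae1 : ∀ᵐ w ∂π, (Q w.2).map Prod.fst = μ i :=
    ae_of_ae_map measurable_snd.aemeasurable (hπ2.symm ▸ hQ1)
  refine ⟨(π ⊗ₘ R).map φ, Measure.isProbabilityMeasure_map hφ.aemeasurable, ?_, ?_, fun c hc => ?_,
    fun j hj c hc => ?_⟩
  · refine (Measure.pi_eq fun s hs => ?_).symm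
    rw [Measure.map_map measurable_fst hφ,
      Measure.map_apply (by fun_prop) (MeasurableSet.univ_pi hs),
      Measure.compProd_apply ((measurable_fst.comp hφ) (MeasurableSet.univ_pi hs))]
    let t : ∀ j, Set (X j) := Function.update s i Set.univ
    have ht (j) : MeasurableSet (t j) := by
      rcases eq_or_ne j i with rfl | h
      · simp [t]
      · simpa [t, h] using hs j
    have hmem (x : ∀ j, X j) (a : X i) :
        Function.update x i a ∈ Set.univ.pi s ↔ x ∈ Set.univ.pi t ∧ a ∈ s i := by
      simp only [Set.mem_univ_pi]
      constructor
      · refine fun h => ⟨fun j => ?_, by simpa using h i⟩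
        rcases eq_or_ne j i with rfl | hj
        · simp [t]
        · simpa [t, hj] using h j
      · rintro ⟨h, ha⟩ j
        rcases eq_or_ne j i with rfl | hj
        · simpa using ha
        · simpa [t, hj] using h j
    calc ∫⁻ w, Q w.2 {p | Function.update w.1 i p.1 ∈ Set.univ.pi s} ∂π
        = ∫⁻ w, (Prod.fst ⁻¹' Set.univ.pi t).indicator (fun _ => μ i (s i)) w ∂π := by
          refine lintegral_congr_ae ?_
          filter_upwards [hae1] with w hw
          by_cases h : w.1 ∈ Set.univ.pi t
          · rw [Set.indicator_of_mem (show w ∈ Prod.fst ⁻¹' Set.univ.pi t from h), ← hw,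
              Measure.map_apply measurable_fst (hs i)]
            simp only [hmem, h, true_and]
            rfl
          · rw [Set.indicator_of_notMem (show w ∉ Prod.fst ⁻¹' Set.univ.pi t from h)]
            simp [hmem, h]
      _ = μ i (s i) * ∏ j, μ j (t j) := by
          rw [lintegral_indicator_const (measurable_fst (MeasurableSet.univ_pi ht)),
            ← Measure.map_apply measurable_fst (MeasurableSet.univ_pi ht), hπ1, Measure.pi_pi]
      _ = ∏ j, μ j (s j) := by
          rw [← Finset.mul_prod_erase _ _ (Finset.mem_univ i),
            ← Finset.mul_prod_erase _ (fun j => μ j (s j)) (Finset.mem_univ i)]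
          simp only [t, Function.update_self, measure_univ, one_mul]
          congr 1
          refine Finset.prod_congr rfl fun j hj => ?_
          rw [Function.update_of_ne (Finset.ne_of_mem_erase hj)]
  · ext S hS
    rw [Measure.map_map measurable_snd hφ, Measure.map_apply (by fun_prop) hS,
      Measure.compProd_apply ((measurable_snd.comp hφ) hS), ← lintegral_indicator_one hS,
      hκ _ (measurable_one.indicator hS)]
    have hsec (x : ∀ j, X j) : MeasurableSet {b | Function.update x i b ∈ S} :=
      (measurable_update x) hS
    have hval (x : ∀ j, X j) : ∫⁻ y, S.indicator 1 (Function.update x i y) ∂κ x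
        = κ x {b | Function.update x i b ∈ S} :=
      lintegral_indicator_one (hsec x)
    simp_rw [hval]
    calc ∫⁻ w, Q w.2 {p | Function.update w.2 i p.2 ∈ S} ∂π
        = ∫⁻ x, Q x {p | Function.update x i p.2 ∈ S} ∂ν := by
          rw [← hπ2, lintegral_map ?_ measurable_snd]
          exact Kernel.measurable_kernel_prodMk_left (κ := Q)
            (t := {z | Function.update z.1 i z.2.2 ∈ S})
            ((hup.comp (f := fun z : (∀ j, X j) × X i × X i => (z.1, z.2.2)) (by fun_prop)) hS)
      _ = _ := by
          refine lintegral_congr_ae ?_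
          filter_upwards [hQ2] with x hx
          rw [← hx, Measure.map_apply measurable_snd (hsec x)]
          rfl
  · have hcm : Measurable fun z : (∀ j, X j) × (∀ j, X j) => c (z.1 i) (z.2 i) :=
      hc.comp (f := fun z : (∀ j, X j) × (∀ j, X j) => (z.1 i, z.2 i)) (by fun_prop)
    rw [lintegral_map hcm hφ, Measure.lintegral_compProd (f := fun w => c ((φ w).1 i) ((φ w).2 i))
      (hcm.comp hφ), ← hπ2, lintegral_map hc.lintegral_kernel measurable_snd]
    simp [φ, R]
  · have hcm : Measurable fun z : (∀ j, X j) × (∀ j, X j) => c (z.1 j) (z.2 j) :=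
      hc.comp (f := fun z : (∀ j, X j) × (∀ j, X j) => (z.1 j, z.2 j)) (by fun_prop)
    rw [lintegral_map hcm hφ, Measure.lintegral_compProd (f := fun w => c ((φ w).1 j) ((φ w).2 j))
      (hcm.comp hφ)]
    simp [φ, Function.update_of_ne hj]

/-- The lower Lebesgue integral is superadditive, without measurability assumptions. -/
theorem sum_lintegral_le_lintegral_sum {α ι : Type*} [MeasurableSpace α] (ν : Measure α)
    (s : Finset ι) (f : ι → α → ℝ≥0∞) :
    ∑ i ∈ s, ∫⁻ x, f i x ∂ν ≤ ∫⁻ x, ∑ i ∈ s, f i x ∂ν := by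
  classical
  induction s using Finset.induction_on with
  | empty => simp
  | insert i s hi ih =>
    simp_rw [Finset.sum_insert hi]
    exact (add_le_add_right ih _).trans (le_lintegral_add _ _)

/-- **Sub-additivity of the transportation cost for a product measure.** Let `μ = ⊗ᵢ μᵢ`
be a product probability measure on a product of Polish spaces, `ν` any probability
measure on the product, and for each `i` let `κ i x` be the regular conditional
distribution under `ν` of the `i`-th coordinate given the remaining coordinates of `x`.
Then with the sum cost `(⊕ᵢcᵢ)(x,y) = Σᵢ cᵢ(xᵢ,yᵢ)` of lower semicontinuous costs `cᵢ`,
`T_{⊕ᵢcᵢ}(μ, ν) ≤ ∫ Σᵢ T_{cᵢ}(μᵢ, κ i x) dν(x)`. -/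
theorem transportCost_product_subadditive {n : ℕ} (X : Fin n → Type*)
    [∀ i, MeasurableSpace (X i)] [∀ i, TopologicalSpace (X i)]
    [∀ i, PolishSpace (X i)] [∀ i, BorelSpace (X i)]
    (c : ∀ i, X i → X i → ENNReal)
    (hc : ∀ i, LowerSemicontinuous (fun p : X i × X i => c i p.1 p.2))
    (μ : ∀ i, Measure (X i)) [∀ i, IsProbabilityMeasure (μ i)]
    (ν : Measure (∀ i, X i)) [IsProbabilityMeasure ν]
    (κ : ∀ i : Fin n, (∀ j, X j) → Measure (X i))
    (hκ_meas : ∀ i, Measurable (κ i))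
    (hκ_prob : ∀ i x, IsProbabilityMeasure (κ i x))
    (hκ_dep : ∀ i (x x' : ∀ j, X j), (∀ j, j ≠ i → x j = x' j) → κ i x = κ i x')
    (hκ_disint : ∀ i (F : (∀ j, X j) → ENNReal), Measurable F →
      ∫⁻ x, F x ∂ν = ∫⁻ x, ∫⁻ y, F (Function.update x i y) ∂(κ i x) ∂ν) :
    transportCost (fun x y => ∑ i, c i (x i) (y i)) (Measure.pi μ) ν ≤
      ∫⁻ x, ∑ i, transportCost (c i) (μ i) (κ i x) ∂ν := by
  have hcm (i) : Measurable fun p : X i × X i => c i p.1 p.2 := (hc i).measurable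
  let K (i) : Kernel (∀ j, X j) (X i) := ⟨κ i, hκ_meas i⟩
  have hK (i) : IsMarkovKernel (K i) := ⟨hκ_prob i⟩
  have main {ε : ℝ≥0∞} (hε : ε ≠ 0) (s : Finset (Fin n)) :
      ∃ π : Measure ((∀ j, X j) × (∀ j, X j)), IsProbabilityMeasure π ∧
        π.map Prod.fst = Measure.pi μ ∧ π.map Prod.snd = ν ∧ ∀ i ∈ s,
          ∫⁻ z, c i (z.1 i) (z.2 i) ∂π ≤ ∫⁻ x, transportCost (c i) (μ i) (κ i x) ∂ν + ε := by
    induction s using Finset.induction_on with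
    | empty =>
      exact ⟨(Measure.pi μ).prod ν, inferInstance, by simp [Measure.map_fst_prod],
        by simp [Measure.map_snd_prod], by simp⟩
    | insert i s hi ih =>
      obtain ⟨π, hπ, hπ1, hπ2, hπs⟩ := ih
      obtain ⟨Q, hQ, hQ1, hQ2, hQc⟩ :=
        exists_kernel_coupling (P := ν) (μ := μ i) (κ := K i) (hc i) hε
      obtain ⟨π', hπ', h1, h2, hi', hj'⟩ :=
        exists_coupling_resample (hκ_disint i) hQ1 hQ2 hπ1 hπ2
      refine ⟨π', hπ', h1, h2, fun j hj => ?_⟩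
      rcases eq_or_ne j i with rfl | hji
      · rw [hi' (c j) (hcm j)]
        exact hQc
      · rw [hj' j hji (c j) (hcm j)]
        exact hπs j (Finset.mem_of_mem_insert_of_ne hj hji)
  have bound {ε : ℝ≥0∞} (hε : ε ≠ 0) :
      transportCost (fun x y => ∑ i, c i (x i) (y i)) (Measure.pi μ) ν ≤
        ∫⁻ x, ∑ i, transportCost (c i) (μ i) (κ i x) ∂ν + n * ε := by
    obtain ⟨π, -, h1, h2, hπ⟩ := main hε Finset.univ
    have hci (i) : Measurable fun z : (∀ j, X j) × (∀ j, X j) => c i (z.1 i) (z.2 i) :=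
      (hcm i).comp (f := fun z : (∀ j, X j) × (∀ j, X j) => (z.1 i, z.2 i)) (by fun_prop)
    calc _ ≤ ∫⁻ z, ∑ i, c i (z.1 i) (z.2 i) ∂π := iInf_le_of_le π <| iInf₂_le h1 h2
      _ = ∑ i, ∫⁻ z, c i (z.1 i) (z.2 i) ∂π := lintegral_finsetSum _ fun i _ => hci i
      _ ≤ ∑ i, (∫⁻ x, transportCost (c i) (μ i) (κ i x) ∂ν + ε) :=
          Finset.sum_le_sum fun i hi => hπ i hi
      _ = ∑ i, ∫⁻ x, transportCost (c i) (μ i) (κ i x) ∂ν + n * ε := by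
          simp [Finset.sum_add_distrib]
      _ ≤ _ := by
          gcongr
          exact sum_lintegral_le_lintegral_sum ν _ _
  refine ENNReal.le_of_forall_pos_le_add fun δ hδ _ => (bound (ε := δ / (n + 1)) ?_).trans ?_
  · exact (ENNReal.div_pos (by simpa using hδ.ne') (by finiteness)).ne'
  · gcongr
    calc (n : ℝ≥0∞) * (δ / (n + 1)) ≤ (n + 1) * (δ / (n + 1)) := by gcongr; exact le_self_add
      _ ≤ δ := ENNReal.mul_div_le
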